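/- For any integers q ≥ 2, k ≥ 2, n ≥ 1, any indices i, j ∈ [k] and any integer s ≥ 1, the family of all (s·𝟙_i)-CECCs in Φ_{q,k}^n and the family of all (s·𝟙_j)-CECCs in Φ_{q,k}^n are equivalent, where s·𝟙_i denotes the tuple in ℕ^k whose i-th entry is s and whose other entries are 0. -/

import Mathlib

/-- A sequence in `Φ_{q,k}^n`, viewed as a `k × n` matrix over `Σ_q = Fin q`,
is valid if every column is nondecreasing. -/
def ValidSeq (q k n : ℕ) (s : Fin k → Fin n → Fin q) : Prop :=
  ∀ j : Fin n, Monotone fun i : Fin k => s i j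

/-- The set `Φ_{q,k}^n` of ordered composite sequences. -/
def Phi (q k n : ℕ) := {s : Fin k → Fin n → Fin q // ValidSeq q k n s}

/-- `C ⊆ Φ_{q,k}^n` is an `(e 0, …, e (k-1))`-CECC. -/
def IsCECC (q k n : ℕ) (e : Fin k → ℕ) (C : Set (Phi q k n)) : Prop :=
  ∀ c ∈ C, ∀ c' ∈ C, c ≠ c' →
    ¬ ∃ y : Fin k → Fin n → Fin q,
        ∀ i : Fin k, hammingDist (y i) (c.1 i) ≤ e i ∧ hammingDist (y i) (c'.1 i) ≤ e i

/-- The tuple `s·𝟙_i ∈ ℕ^k`. -/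
def unitTuple (k : ℕ) (i : Fin k) (s : ℕ) : Fin k → ℕ :=
  fun r => if r = i then s else 0

def loV {q k n : ℕ} (i : Fin k) (c : Phi q k n) (t : Fin n) : ℕ :=
  if i.1 = 0 then 0 else (c.1 ⟨i.1 - 1, by omega⟩ t).1

def hiV {q k n : ℕ} (j : Fin k) (c : Phi q k n) (t : Fin n) : ℕ :=
  if h : j.1 + 1 < k then (c.1 ⟨j.1 + 1, h⟩ t).1 else q - 1

theorem loV_le {q k n : ℕ} (i : Fin k) (c : Phi q k n) (t : Fin n) (r : Fin k)
    (h : i ≤ r) : loV i c t ≤ (c.1 r t).1 := by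
  unfold loV
  split_ifs with h0
  · omega
  · exact c.2 t (show (⟨i.1 - 1, _⟩ : Fin k) ≤ r by
      rw [Fin.le_def] at h ⊢; simp only; omega)

theorem loV_le' {q k n : ℕ} (i : Fin k) (c : Phi q k n) (t : Fin n) (r : Fin k)
    (h : r < i) : (c.1 r t).1 ≤ loV i c t := by
  unfold loV
  rw [Fin.lt_def] at h
  rw [if_neg (by omega)]
  exact c.2 t (show r ≤ (⟨i.1 - 1, _⟩ : Fin k) by
      rw [Fin.le_def]; simp only; omega)

theorem le_hiV {q k n : ℕ} (j : Fin k) (c : Phi q k n) (t : Fin n) (r : Fin k)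
    (h : r ≤ j) : (c.1 r t).1 ≤ hiV j c t := by
  unfold hiV
  split_ifs with h0
  · exact c.2 t (show r ≤ (⟨j.1 + 1, _⟩ : Fin k) by
      rw [Fin.le_def] at h ⊢; simp only; omega)
  · have := (c.1 r t).2
    omega

theorem hiV_le {q k n : ℕ} (j : Fin k) (c : Phi q k n) (t : Fin n) (r : Fin k)
    (h : j < r) : hiV j c t ≤ (c.1 r t).1 := by
  unfold hiV
  rw [Fin.lt_def] at h
  rw [dif_pos (by omega)]
  exact c.2 t (show (⟨j.1 + 1, _⟩ : Fin k) ≤ r by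
      rw [Fin.le_def]; simp only; omega)

theorem hiV_lt {q k n : ℕ} (hq : 2 ≤ q) (j : Fin k) (c : Phi q k n) (t : Fin n) :
    hiV j c t < q := by
  unfold hiV
  split_ifs
  · exact Fin.is_lt _
  · omega

def rr {k : ℕ} (i j r : Fin k) (h : i ≤ r ∧ r ≤ j) : Fin k :=
  ⟨i.1 + j.1 - r.1, by have := h.1; have := h.2; rw [Fin.le_def] at *; omega⟩

theorem rr_mem {k : ℕ} (i j r : Fin k) (h : i ≤ r ∧ r ≤ j) :
    i ≤ rr i j r h ∧ rr i j r h ≤ j := by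
  have := h.1; have := h.2
  simp only [rr, Fin.le_def] at *; omega

theorem rr_rr {k : ℕ} (i j r : Fin k) (h : i ≤ r ∧ r ≤ j) :
    rr i j (rr i j r h) (rr_mem i j r h) = r := by
  have := h.1; have := h.2
  simp only [rr, Fin.le_def, Fin.ext_iff] at *; omega

def gfun {q k n : ℕ} (hq : 2 ≤ q) (i j : Fin k) (c : Phi q k n) : Phi q k n :=
  ⟨fun r t => if h : i ≤ r ∧ r ≤ j then
      ⟨loV i c t + hiV j c t - (c.1 (rr i j r h) t).1, by
        have h1 := loV_le i c t _ (rr_mem i j r h).1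
        have h2 := hiV_lt hq j c t
        omega⟩
    else c.1 r t, by
    intro t a b hab
    have hm := c.2 t hab
    simp only at hm ⊢
    split_ifs with ha hb hb
    · rw [Fin.le_def]; simp only
      have : (c.1 (rr i j b hb) t).1 ≤ (c.1 (rr i j a ha) t).1 := by
        refine c.2 t ?_
        simp only [rr, Fin.le_def] at *; omega
      omega
    · rw [Fin.le_def]; simp only
      have h1 := loV_le i c t _ (rr_mem i j a ha).1
      have h2 := hiV_le j c t b (by
        simp only [Fin.le_def, Fin.lt_def] at *; omega)
      omega
    · rw [Fin.le_def]; simp only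
      have h1 := le_hiV j c t _ (rr_mem i j b hb).2
      have h2 := loV_le' i c t a (by
        simp only [Fin.le_def, Fin.lt_def] at *; omega)
      omega
    · exact hm⟩

theorem gfun_in {q k n : ℕ} (hq : 2 ≤ q) (i j : Fin k) (c : Phi q k n) (r : Fin k) (t : Fin n)
    (h : i ≤ r ∧ r ≤ j) :
    ((gfun hq i j c).1 r t).1 = loV i c t + hiV j c t - (c.1 (rr i j r h) t).1 := by
  simp only [gfun]; rw [dif_pos h]

theorem gfun_out {q k n : ℕ} (hq : 2 ≤ q) (i j : Fin k) (c : Phi q k n) (r : Fin k) (t : Fin n)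
    (h : ¬ (i ≤ r ∧ r ≤ j)) : (gfun hq i j c).1 r t = c.1 r t := by
  simp only [gfun]; rw [dif_neg h]

theorem gfun_inv {q k n : ℕ} (hq : 2 ≤ q) (i j : Fin k) (c : Phi q k n) :
    gfun hq i j (gfun hq i j c) = c := by
  apply Subtype.ext
  funext r t
  by_cases h : i ≤ r ∧ r ≤ j
  · apply Fin.ext
    rw [gfun_in hq i j _ r t h, gfun_in hq i j c _ t (rr_mem i j r h), rr_rr]
    have hl : loV i (gfun hq i j c) t = loV i c t := by
      unfold loV
      split_ifs with h0
      · rfl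
      · rw [gfun_out]; simp only [Fin.le_def]; omega
    have hh : hiV j (gfun hq i j c) t = hiV j c t := by
      unfold hiV
      split_ifs with h0
      · rw [gfun_out]; simp only [Fin.le_def]; omega
      · rfl
    rw [hl, hh]
    have := loV_le i c t r h.1
    have := le_hiV j c t r h.2
    omega
  · rw [gfun_out hq i j _ r t h, gfun_out hq i j _ r t h]

/-- agreement of columns off a row -/
def RowTrans {q k n : ℕ} (g : Phi q k n → Phi q k n) (i j : Fin k) : Prop :=
  ∀ c c' : Phi q k n, ∀ t : Fin n, (∀ r, r ≠ i → c.1 r t = c'.1 r t) →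
    (∀ r, r ≠ j → (g c).1 r t = (g c').1 r t) ∧
    (c.1 i t = c'.1 i t → (g c).1 j t = (g c').1 j t)

theorem gfun_congr {q k n : ℕ} (hq : 2 ≤ q) (i j : Fin k) (hij : i ≤ j) (c c' : Phi q k n)
    (a b : Fin k) (hab : (a = i ∧ b = j) ∨ (a = j ∧ b = i)) (t : Fin n)
    (H : ∀ r, r ≠ a → c.1 r t = c'.1 r t) (r : Fin k) (hr : r ≠ b ∨ c.1 a t = c'.1 a t) :
    (gfun hq i j c).1 r t = (gfun hq i j c').1 r t := by
  have hl : loV i c t = loV i c' t := by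
    unfold loV
    split_ifs with h0
    · rfl
    · rw [H]
      rcases hab with ⟨rfl, rfl⟩ | ⟨rfl, rfl⟩ <;> simp only [Fin.le_def, ne_eq, Fin.ext_iff] at * <;> omega
  have hh : hiV j c t = hiV j c' t := by
    unfold hiV
    split_ifs with h0
    · rw [H]
      rcases hab with ⟨rfl, rfl⟩ | ⟨rfl, rfl⟩ <;> simp only [Fin.le_def, ne_eq, Fin.ext_iff] at * <;> omega
    · rfl
  have key : ∀ r', (r' = a → c.1 a t = c'.1 a t) → c.1 r' t = c'.1 r' t := by
    intro r' h
    by_cases e : r' = a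
    · rw [e]; exact h e
    · exact H _ e
  by_cases h : i ≤ r ∧ r ≤ j
  · apply Fin.ext
    rw [gfun_in hq i j _ r t h, gfun_in hq i j _ r t h, hl, hh, key]
    intro e
    rcases hr with hr | hr
    · exfalso; apply hr
      have := h.1; have := h.2
      rcases hab with ⟨rfl, rfl⟩ | ⟨rfl, rfl⟩ <;>
        simp only [rr, Fin.le_def, Fin.ext_iff] at * <;> omega
    · exact hr
  · rw [gfun_out hq i j _ r t h, gfun_out hq i j _ r t h]
    apply H
    rintro rfl
    apply h
    rcases hab with ⟨rfl, rfl⟩ | ⟨rfl, rfl⟩ <;> simp [hij]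

theorem transfer {q k n : ℕ} (g : Phi q k n → Phi q k n) (hg : ∀ c, g (g c) = c) (i j : Fin k)
    (h1 : RowTrans g i j) (h2 : RowTrans g j i) (s : ℕ) (C : Set (Phi q k n))
    (hC : IsCECC q k n (unitTuple k i s) C) : IsCECC q k n (unitTuple k j s) (g '' C) := by
  rintro _ ⟨c, hc, rfl⟩ _ ⟨c', hc', rfl⟩ hne ⟨y, hy⟩
  refine hC c hc c' hc' (fun e => hne (by rw [e])) ?_
  have off : ∀ r, r ≠ j → ∀ t, (g c).1 r t = (g c').1 r t := by
    intro r hr t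
    have := hy r
    simp only [unitTuple, if_neg hr, Nat.le_zero, hammingDist_eq_zero] at this
    rw [← this.1, ← this.2]
  have hT := fun t => h2 (g c) (g c') t (fun r hr => off r hr t)
  simp only [hg] at hT
  have hj := hy j
  simp only [unitTuple, if_true] at hj
  refine ⟨fun r t => if y j t = (g c').1 j t then c'.1 r t else c.1 r t, fun r => ?_⟩
  by_cases hr : r = i
  · subst hr
    simp only [unitTuple, if_true]
    refine ⟨le_trans ?_ hj.1, le_trans ?_ hj.2⟩
    · apply Finset.card_le_card
      intro t
      simp only [Finset.mem_filter, Finset.mem_univ, true_and]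
      split_ifs with e
      · intro h e2
        exact h ((hT t).2 (e2.symm.trans e)).symm
      · intro h; exact absurd rfl h
    · apply Finset.card_le_card
      intro t
      simp only [Finset.mem_filter, Finset.mem_univ, true_and]
      split_ifs with e
      · intro h; exact absurd rfl h
      · intro _; exact e
  · have hz : ∀ t, c.1 r t = c'.1 r t := fun t => (hT t).1 r hr
    simp only [unitTuple, if_neg hr, Nat.le_zero, hammingDist_eq_zero]
    constructor <;> funext t <;> simp [hz]

/-- For any `i, j ∈ [k]` and `s ≥ 1`, the families of `(s·𝟙_i)`-CECCs and
`(s·𝟙_j)`-CECCs in `Φ_{q,k}^n` are equivalent. -/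
theorem stmt1 (q k n : ℕ) (hq : 2 ≤ q) (hk : 2 ≤ k) (hn : 1 ≤ n)
    (i j : Fin k) (s : ℕ) (hs : 1 ≤ s) :
    ∃ g : Phi q k n ≃ Phi q k n,
      (∀ C : Set (Phi q k n),
        IsCECC q k n (unitTuple k i s) C → IsCECC q k n (unitTuple k j s) (⇑g '' C)) ∧
      (∀ C : Set (Phi q k n),
        IsCECC q k n (unitTuple k j s) C → IsCECC q k n (unitTuple k i s) (⇑g.symm '' C)) := by
  have main : ∀ i j : Fin k, i ≤ j → ∃ g : Phi q k n → Phi q k n, (∀ c, g (g c) = c) ∧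
      RowTrans g i j ∧ RowTrans g j i := by
    intro i j hij
    refine ⟨gfun hq i j, gfun_inv hq i j, ?_, ?_⟩
    · intro c c' t H
      exact ⟨fun r hr => gfun_congr hq i j hij c c' i j (Or.inl ⟨rfl, rfl⟩) t H r (Or.inl hr),
        fun h => gfun_congr hq i j hij c c' i j (Or.inl ⟨rfl, rfl⟩) t H j (Or.inr h)⟩
    · intro c c' t H
      exact ⟨fun r hr => gfun_congr hq i j hij c c' j i (Or.inr ⟨rfl, rfl⟩) t H r (Or.inl hr),
        fun h => gfun_congr hq i j hij c c' j i (Or.inr ⟨rfl, rfl⟩) t H i (Or.inr h)⟩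
  have main2 : ∃ g : Phi q k n → Phi q k n, (∀ c, g (g c) = c) ∧
      RowTrans g i j ∧ RowTrans g j i := by
    rcases le_total i j with h | h
    · exact main i j h
    · obtain ⟨g, h0, h1, h2⟩ := main j i h
      exact ⟨g, h0, h2, h1⟩
  obtain ⟨g, h0, h1, h2⟩ := main2
  exact ⟨⟨g, g, h0, h0⟩, fun C hC => transfer g h0 i j h1 h2 s C hC,
    fun C hC => transfer g h0 j i h2 h1 s C hC⟩
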